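/- Let M = ⊕_{m ≥ 0, m ∈ (1/T)ℤ} M(m) be an admissible g-twisted V-module with M(0) ≠ 0. Then Ω_n(M) contains ⊕_{0 ≤ i ≤ n} M(i), and if M is simple then Ω_n(M) = ⊕_{0 ≤ i ≤ n} M(i). -/

import Mathlib

/-
Common framework for formalizing
"Twisted representations of vertex operator algebras and associative algebras"
by C. Dong, H. Li, G. Mason.

We formalize a vertex operator algebra `V` over `ℂ` through its modes
`u_m = mode u m` (`m : ℤ`), vacuum `𝟏`, conformal vector `ω` (so that
`L(n) = ω_{n+1}`), a weight grading `wtSpace`, and the Borcherds identity.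
An automorphism `g` of finite order `T` gives eigenspaces
`V^r = eigSpace V g T r`.  For `n = l + i/T` the subspace `O_{g,n}(V)` is
`Ogn V g T l i`, the product `*_{g,n}` is `starMul V g T l`
(it only depends on `l`), and `A_{g,n}(V) = V.carrier ⧸ Ogn V g T l i`.
-/

noncomputable section

open scoped BigOperators

namespace DLM

/-- Generalized binomial coefficient `binom(α, j)` for a rational `α`. -/
def qchoose (α : ℚ) (j : ℕ) : ℚ :=
  (∏ k ∈ Finset.range j, (α - (k : ℚ))) / (Nat.factorial j : ℚ)

/-- A vertex operator algebra over `ℂ`, given by its modes `u_m v = mode u m v`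
(the coefficients of `Y(u,z)v`), the vacuum `𝟏`, the conformal vector `ω`
(with `L(n) = ω_{n+1}`), and the integer weight grading. -/
structure VOA where
  carrier : Type
  [acg : AddCommGroup carrier]
  [mod : Module ℂ carrier]
  mode : carrier →ₗ[ℂ] (ℤ → carrier →ₗ[ℂ] carrier)
  vacuum : carrier
  conformal : carrier
  wtSpace : ℤ → Submodule ℂ carrier
  [decomp : DirectSum.Decomposition wtSpace]
  findim : ∀ k : ℤ, FiniteDimensional ℂ (wtSpace k)
  bounded_below : ∃ N : ℤ, ∀ k : ℤ, k < N → wtSpace k = ⊥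
  trunc : ∀ u v : carrier, ∃ N : ℤ, ∀ m : ℤ, N ≤ m → mode u m v = 0
  vacuum_wt : vacuum ∈ wtSpace 0
  conformal_wt : conformal ∈ wtSpace 2
  vacuum_mode : ∀ (m : ℤ) (v : carrier), mode vacuum m v = if m = -1 then v else 0
  creation₁ : ∀ u : carrier, mode u (-1) vacuum = u
  creation₂ : ∀ (u : carrier) (m : ℤ), 0 ≤ m → mode u m vacuum = 0
  L0_grading : ∀ (k : ℤ), ∀ v ∈ wtSpace k, mode conformal 1 v = (k : ℂ) • v
  mode_grading : ∀ (a b m : ℤ) (u v : carrier), u ∈ wtSpace a → v ∈ wtSpace b →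
    mode u m v ∈ wtSpace (a + b - m - 1)
  Lneg1_mode : ∀ (u : carrier) (m : ℤ),
    mode (mode conformal 0 u) m = (-(m : ℂ)) • (mode u (m - 1))
  borcherds : ∀ (u v w : carrier) (p q s : ℤ),
    ∑ᶠ j : ℕ, ((qchoose (p : ℚ) j : ℚ) : ℂ) • mode (mode u (s + j) v) (p + q - j) w =
    ∑ᶠ j : ℕ, ((-1 : ℂ) ^ j * ((qchoose (s : ℚ) j : ℚ) : ℂ)) •
      (mode u (p + s - j) (mode v (q + j) w)
        - ((-1 : ℂ) ^ s) • mode v (q + s - j) (mode u (p + j) w))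

attribute [instance] VOA.acg VOA.mod VOA.decomp

namespace VOA

/-- Projection of `u` onto its weight `k` homogeneous component. -/
def proj (V : VOA) (k : ℤ) (u : V.carrier) : V.carrier :=
  (((DirectSum.decompose V.wtSpace u) k : V.wtSpace k) : V.carrier)

/-- `res V α β u v = Res_z Y(u,z)v (1+z)^α z^{-β}
  = ∑_{j ≥ 0} binom(α, j) u_{j - β} v`. -/
def res (V : VOA) (α : ℚ) (β : ℤ) (u v : V.carrier) : V.carrier :=
  ∑ᶠ j : ℕ, ((qchoose α j : ℚ) : ℂ) • V.mode u ((j : ℤ) - β) v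

end VOA

/-- An automorphism of a vertex operator algebra. -/
structure VOAAut (V : VOA) where
  lin : V.carrier ≃ₗ[ℂ] V.carrier
  map_vacuum : lin V.vacuum = V.vacuum
  map_conformal : lin V.conformal = V.conformal
  map_mode : ∀ (u : V.carrier) (m : ℤ) (v : V.carrier),
    lin (V.mode u m v) = V.mode (lin u) m (lin v)
  map_wt : ∀ (k : ℤ) (u : V.carrier), u ∈ V.wtSpace k ↔ lin u ∈ V.wtSpace k

/-- The inverse automorphism `g⁻¹`. -/
def VOAAut.symm {V : VOA} (g : VOAAut V) : VOAAut V where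
  lin := g.lin.symm
  map_vacuum := g.lin.injective (by rw [LinearEquiv.apply_symm_apply, g.map_vacuum])
  map_conformal := g.lin.injective (by rw [LinearEquiv.apply_symm_apply, g.map_conformal])
  map_mode := fun u m v => g.lin.injective (by
    rw [LinearEquiv.apply_symm_apply, g.map_mode, LinearEquiv.apply_symm_apply,
      LinearEquiv.apply_symm_apply])
  map_wt := fun k u => by
    have h := (g.map_wt k (g.lin.symm u)).symm
    rwa [LinearEquiv.apply_symm_apply] at h

/-- The eigenspace `V^r = {v ∈ V | g v = e^{-2πir/T} v}`. -/
def eigSpace (V : VOA) (g : VOAAut V) (T r : ℕ) : Submodule ℂ V.carrier where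
  carrier := {v | g.lin v =
    Complex.exp (-(2 * (Real.pi : ℂ) * Complex.I * (r : ℂ)) / (T : ℂ)) • v}
  add_mem' := fun {a b} ha hb => by
    simp only [Set.mem_setOf_eq] at *
    rw [map_add, ha, hb, smul_add]
  zero_mem' := by simp
  smul_mem' := fun c a ha => by
    simp only [Set.mem_setOf_eq] at *
    rw [map_smul, ha, smul_comm]

/-- `δ_i(r)`: equals `1` if `r ≤ i` or `r = T`, and `0` otherwise. -/
def deltaI (T i r : ℕ) : ℕ := if r ≤ i ∨ r = T then 1 else 0

/-- `O_{g,n}(V)` for `n = l + i/T`: the span of all `L(-1)u + L(0)u` and all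
`u ∘_{g,n} v = Res_z Y(u,z)v (1+z)^{wt u - 1 + δ_i(r) + l + r/T}
 / z^{2l + δ_i(r) + δ_i(T-r)}` for homogeneous `u ∈ V^r`. -/
def Ogn (V : VOA) (g : VOAAut V) (T l i : ℕ) : Submodule ℂ V.carrier :=
  Submodule.span ℂ
    ({x | ∃ u : V.carrier, x = V.mode V.conformal 0 u + V.mode V.conformal 1 u} ∪
     {x | ∃ r : ℕ, r < T ∧ ∃ (k : ℤ) (u v : V.carrier),
        u ∈ V.wtSpace k ∧ u ∈ eigSpace V g T r ∧
        x = V.res ((k : ℚ) - 1 + (deltaI T i r : ℚ) + (l : ℚ) + (r : ℚ) / (T : ℚ))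
              (2 * (l : ℤ) + (deltaI T i r : ℤ) + (deltaI T i (T - r) : ℤ)) u v})

/-- The product `u *_{g,n} v` for `u` homogeneous of weight `k` in `V^0`:
`∑_{m=0}^{l} (-1)^m binom(m+l, l) Res_z Y(u,z) (1+z)^{wt u + l} z^{-(l+m+1)} v`. -/
def starFor (V : VOA) (l : ℕ) (k : ℤ) (u v : V.carrier) : V.carrier :=
  ∑ m ∈ Finset.range (l + 1),
    ((-1 : ℂ) ^ m * (Nat.choose (m + l) l : ℂ)) •
      V.res ((k : ℚ) + (l : ℚ)) ((l : ℤ) + (m : ℤ) + 1) u v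

/-- Projection onto the eigenspace `V^r` of the finite order automorphism `g`. -/
def eigProj (V : VOA) (g : VOAAut V) (T r : ℕ) (v : V.carrier) : V.carrier :=
  (T : ℂ)⁻¹ • ∑ t ∈ Finset.range T,
    Complex.exp ((2 * (Real.pi : ℂ) * Complex.I * (r : ℂ) * (t : ℂ)) / (T : ℂ)) •
      ((g.lin ^ t) v)

/-- The bilinear extension of `*_{g,n}` to all of `V` (it vanishes when the first
argument is homogeneous in `V^r`, `r ≠ 0`, and only depends on `l`). -/
def starMul (V : VOA) (g : VOAAut V) (T l : ℕ) (u v : V.carrier) : V.carrier :=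
  ∑ᶠ k : ℤ, starFor V l k (eigProj V g T 0 (V.proj k u)) v

/-- The subspace `O_{1,l}(V^0)` of the untwisted theory of the fixed point
subalgebra `V^0` (all `δ` terms equal `1`), viewed inside `V`. -/
def OgnV0 (V : VOA) (g : VOAAut V) (T l : ℕ) : Submodule ℂ V.carrier :=
  Submodule.span ℂ
    ({x | ∃ u ∈ eigSpace V g T 0, x = V.mode V.conformal 0 u + V.mode V.conformal 1 u} ∪
     {x | ∃ (k : ℤ) (u v : V.carrier),
        u ∈ V.wtSpace k ∧ u ∈ eigSpace V g T 0 ∧ v ∈ eigSpace V g T 0 ∧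
        x = V.res ((k : ℚ) + (l : ℚ)) (2 * (l : ℤ) + 2) u v})

/-- `e^{L(1)} v` (where `L(1) = ω_2`). -/
def expL1 (V : VOA) (v : V.carrier) : V.carrier :=
  ∑ᶠ j : ℕ, ((Nat.factorial j : ℂ))⁻¹ • ((fun w => V.mode V.conformal 2 w)^[j] v)

/-- The map `φ : v ↦ e^{L(1)} (-1)^{L(0)} v`. -/
def phiMap (V : VOA) (v : V.carrier) : V.carrier :=
  ∑ᶠ k : ℤ, ((-1 : ℂ) ^ k) • expL1 V (V.proj k v)

/-- `l`-component of `n - 1/T` when `n = l + i/T`. -/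
def predL (l i : ℕ) : ℕ := if i = 0 then l - 1 else l

/-- `i`-component of `n - 1/T` when `n = l + i/T`. -/
def predI (T i : ℕ) : ℕ := if i = 0 then T - 1 else i - 1

/-- The rational number `n = l + i/T`. -/
def nval (T l i : ℕ) : ℚ := (l : ℚ) + (i : ℚ) / (T : ℚ)

/-- A weak `g`-twisted `V`-module: modes `v_m = act v m` for `m ∈ (1/T)ℤ ⊆ ℚ`,
satisfying the truncation, vacuum and twisted Borcherds (Jacobi) identities. -/
structure TwModule (V : VOA) (g : VOAAut V) (T : ℕ) where
  carrier : Type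
  [acg : AddCommGroup carrier]
  [mod : Module ℂ carrier]
  act : V.carrier →ₗ[ℂ] (ℚ → carrier →ₗ[ℂ] carrier)
  act_eig : ∀ r : ℕ, r < T → ∀ u ∈ eigSpace V g T r, ∀ m : ℚ,
    (¬ ∃ z : ℤ, m = (z : ℚ) + (r : ℚ) / (T : ℚ)) → act u m = 0
  act_trunc : ∀ (u : V.carrier) (x : carrier), ∃ N : ℤ, ∀ m : ℚ, (N : ℚ) ≤ m → act u m x = 0
  act_vacuum : ∀ (m : ℚ) (x : carrier), act V.vacuum m x = if m = -1 then x else 0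
  jacobi : ∀ r s : ℕ, r < T → s < T → ∀ u ∈ eigSpace V g T r, ∀ v ∈ eigSpace V g T s,
    ∀ (a b c : ℤ) (x : carrier),
    ∑ᶠ j : ℕ, ((qchoose ((r : ℚ) / (T : ℚ) + (a : ℚ)) j : ℚ) : ℂ) •
        act (V.mode u (c + j) v) ((r : ℚ) / (T : ℚ) + (s : ℚ) / (T : ℚ) + a + b - j) x =
    ∑ᶠ j : ℕ, ((-1 : ℂ) ^ j * ((qchoose (c : ℚ) j : ℚ) : ℂ)) •
        (act u ((r : ℚ) / (T : ℚ) + a + c - j) (act v ((s : ℚ) / (T : ℚ) + b + j) x)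
          - ((-1 : ℂ) ^ c) •
            act v ((s : ℚ) / (T : ℚ) + b + c - j) (act u ((r : ℚ) / (T : ℚ) + a + j) x))

attribute [instance] TwModule.acg TwModule.mod

namespace TwModule

variable {V : VOA} {g : VOAAut V} {T : ℕ}

/-- The operator `o_p(a) = a_{wt a - 1 - p}`, extended linearly from homogeneous `a`. -/
def oactL (M : TwModule V g T) (p : ℚ) (a : V.carrier) : M.carrier →ₗ[ℂ] M.carrier :=
  ∑ᶠ k : ℤ, M.act (V.proj k a) ((k : ℚ) - 1 - p)

/-- `Ω_n(M) = {x ∈ M | V[g]_{-k} x = 0 for all k > n}`, i.e. `v_m x = 0` whenever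
`v` is homogeneous of weight `d` and `d - 1 - m < -n`. -/
def Omega (M : TwModule V g T) (n : ℚ) : Submodule ℂ M.carrier where
  carrier := {x | ∀ (k : ℤ) (u : V.carrier), u ∈ V.wtSpace k → ∀ m : ℚ,
    (k : ℚ) - 1 + n < m → M.act u m x = 0}
  add_mem' := fun {a b} ha hb => by
    intro k u hu m hm
    rw [map_add, ha k u hu m hm, hb k u hu m hm, add_zero]
  zero_mem' := fun k u hu m hm => map_zero _
  smul_mem' := fun c a ha => by
    intro k u hu m hm
    rw [map_smul, ha k u hu m hm, smul_zero]

theorem mem_Omega {M : TwModule V g T} {n : ℚ} {x : M.carrier} :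
    x ∈ M.Omega n ↔ ∀ (k : ℤ) (u : V.carrier), u ∈ V.wtSpace k → ∀ m : ℚ,
      (k : ℚ) - 1 + n < m → M.act u m x = 0 := Iff.rfl

/-- `Ω_{n-1/T}(M)`, viewed as a submodule of `Ω_n(M)`. -/
def OmegaSub (M : TwModule V g T) (n : ℚ) : Submodule ℂ (M.Omega n) :=
  (M.Omega (n - 1 / (T : ℚ))).comap (M.Omega n).subtype

/-- The quotient `Ω_n(M)/Ω_{n-1/T}(M)`. -/
abbrev OmegaQ (M : TwModule V g T) (n : ℚ) :=
  (M.Omega n) ⧸ (M.OmegaSub n)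

open Classical in
/-- The action of `o(a)` on `Ω_n(M)` (it does preserve `Ω_n(M)`). -/
def oactOmega (M : TwModule V g T) (n : ℚ) (a : V.carrier) :
    M.Omega n →ₗ[ℂ] M.Omega n :=
  if h : ∀ x ∈ M.Omega n, M.oactL 0 a x ∈ M.Omega n then (M.oactL 0 a).restrict h else 0

open Classical in
/-- The induced action of `o(a)` on `Ω_n(M)/Ω_{n-1/T}(M)`. -/
def oactQ (M : TwModule V g T) (n : ℚ) (a : V.carrier) :
    M.OmegaQ n →ₗ[ℂ] M.OmegaQ n :=
  if h : M.OmegaSub n ≤ (M.OmegaSub n).comap (M.oactOmega n a) then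
    Submodule.mapQ _ _ (M.oactOmega n a) h
  else 0

end TwModule

/-- A morphism of weak `g`-twisted `V`-modules. -/
structure TwHom {V : VOA} {g : VOAAut V} {T : ℕ} (M N : TwModule V g T) where
  toLin : M.carrier →ₗ[ℂ] N.carrier
  comm : ∀ (u : V.carrier) (m : ℚ) (x : M.carrier), toLin (M.act u m x) = N.act u m (toLin x)

namespace TwHom

variable {V : VOA} {g : VOAAut V} {T : ℕ}

def id (M : TwModule V g T) : TwHom M M := ⟨LinearMap.id, fun _ _ _ => rfl⟩

def comp {M N P : TwModule V g T} (f' : TwHom N P) (f : TwHom M N) : TwHom M P :=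
  ⟨f'.toLin.comp f.toLin, fun u m x => by
    simp only [LinearMap.comp_apply, f.comm, f'.comm]⟩

theorem mapsOmega {M N : TwModule V g T} (f : TwHom M N) (n : ℚ) :
    ∀ x ∈ M.Omega n, f.toLin x ∈ N.Omega n := fun x hx k u hu m hm => by
  rw [← f.comm, hx k u hu m hm, map_zero]

/-- The restriction of a morphism to `Ω_n`. -/
def omegaMap {M N : TwModule V g T} (f : TwHom M N) (n : ℚ) :
    M.Omega n →ₗ[ℂ] N.Omega n :=
  f.toLin.restrict (f.mapsOmega n)

/-- The induced map `Ω_n(M)/Ω_{n-1/T}(M) → Ω_n(N)/Ω_{n-1/T}(N)`. -/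
def omegaQMap {M N : TwModule V g T} (f : TwHom M N) (n : ℚ) :
    M.OmegaQ n →ₗ[ℂ] N.OmegaQ n :=
  Submodule.mapQ _ _ (f.omegaMap n) (fun x hx => f.mapsOmega (n - 1 / (T : ℚ)) x.1 hx)

end TwHom

/-- An admissible (`(1/T)ℤ≥0`-graded) `g`-twisted `V`-module. -/
structure AdmTwModule (V : VOA) (g : VOAAut V) (T : ℕ) extends TwModule V g T where
  grade : ℚ → Submodule ℂ carrier
  [gdecomp : DirectSum.Decomposition grade]
  grade_support : ∀ q : ℚ, (q < 0 ∨ ¬ ∃ z : ℤ, q = (z : ℚ) / (T : ℚ)) → grade q = ⊥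
  grade_act : ∀ (k : ℤ) (u : V.carrier), u ∈ V.wtSpace k → ∀ (m p : ℚ), ∀ x ∈ grade p,
    act u m x ∈ grade (p + (k : ℚ) - m - 1)

attribute [instance] AdmTwModule.gdecomp

namespace AdmTwModule

variable {V : VOA} {g : VOAAut V} {T : ℕ}

/-- A submodule invariant under all twisted vertex operators. -/
def InvSub (M : AdmTwModule V g T) (W : Submodule ℂ M.carrier) : Prop :=
  ∀ (u : V.carrier) (m : ℚ), ∀ x ∈ W, M.act u m x ∈ W

/-- A graded submodule (closed under homogeneous components). -/
def GradedSub (M : AdmTwModule V g T) (W : Submodule ℂ M.carrier) : Prop :=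
  ∀ x ∈ W, ∀ q : ℚ, (((DirectSum.decompose M.grade x) q : M.grade q) : M.carrier) ∈ W

/-- A simple (irreducible) admissible module: nonzero, with no proper nonzero
graded submodule. -/
def IsSimple (M : AdmTwModule V g T) : Prop :=
  (∃ x : M.carrier, x ≠ 0) ∧
  ∀ W : Submodule ℂ M.carrier, M.InvSub W → M.GradedSub W → W = ⊥ ∨ W = ⊤

/-- `W` is a simple (irreducible) admissible submodule of `M`. -/
def SubSimple (M : AdmTwModule V g T) (W : Submodule ℂ M.carrier) : Prop :=
  W ≠ ⊥ ∧ ∀ W' : Submodule ℂ M.carrier, W' ≤ W → M.InvSub W' → M.GradedSub W' →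
    W' = ⊥ ∨ W' = W

/-- `M` is a direct sum of irreducible admissible submodules. -/
def CompletelyReducible (M : AdmTwModule V g T) : Prop :=
  ∃ (κ : Type) (S : κ → Submodule ℂ M.carrier),
    (∀ j, M.InvSub (S j) ∧ M.GradedSub (S j) ∧ M.SubSimple (S j)) ∧
    iSupIndep S ∧ (⨆ j, S j) = ⊤

end AdmTwModule

/-- `V` is `g`-rational: every admissible `g`-twisted module is a direct sum of
irreducible admissible `g`-twisted modules. -/
def GRational (V : VOA) (g : VOAAut V) (T : ℕ) : Prop :=
  ∀ M : AdmTwModule V g T, M.CompletelyReducible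

/-- An ordinary `g`-twisted `V`-module: graded by `L(0)`-eigenvalues with
finite dimensional pieces and spectrum bounded below in each congruence class
mod `(1/T)ℤ`. -/
structure OrdTwModule (V : VOA) (g : VOAAut V) (T : ℕ) extends TwModule V g T where
  egrade : ℂ → Submodule ℂ carrier
  [edecomp : DirectSum.Decomposition egrade]
  egrade_L0 : ∀ lam : ℂ, ∀ x ∈ egrade lam, act V.conformal 1 x = lam • x
  egrade_findim : ∀ lam : ℂ, FiniteDimensional ℂ (egrade lam)
  egrade_bounded : ∀ lam : ℂ, ∃ N : ℤ, ∀ m : ℤ, m ≤ N →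
    egrade (lam + (m : ℂ) / (T : ℂ)) = ⊥

attribute [instance] OrdTwModule.edecomp

/-- A module over the associative algebra `A_{g,n}(V)` (with `n = l + i/T`),
given as a representation of `V` that kills `O_{g,n}(V)`, takes the vacuum to
the identity, and turns `*_{g,n}` into composition. -/
structure AMod (V : VOA) (g : VOAAut V) (T l i : ℕ) where
  carrier : Type
  [acg : AddCommGroup carrier]
  [mod : Module ℂ carrier]
  rho : V.carrier →ₗ[ℂ] (carrier →ₗ[ℂ] carrier)
  rho_O : ∀ a ∈ Ogn V g T l i, rho a = 0
  rho_one : rho V.vacuum = LinearMap.id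
  rho_star : ∀ a b : V.carrier, rho (starMul V g T l a b) = (rho a).comp (rho b)

attribute [instance] AMod.acg AMod.mod

namespace AMod

variable {V : VOA} {g : VOAAut V} {T l i : ℕ}

/-- `U` does not factor through `A_{g,n-1/T}(V)`. -/
def NotFactor (U : AMod V g T l i) : Prop :=
  ∃ a ∈ Ogn V g T (predL l i) (predI T i), U.rho a ≠ 0

/-- An invariant subspace. -/
def SubInv (U : AMod V g T l i) (W : Submodule ℂ U.carrier) : Prop :=
  ∀ a : V.carrier, ∀ x ∈ W, U.rho a x ∈ W

/-- `W` is a simple `A_{g,n}(V)`-submodule of `U`. -/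
def SubSimple (U : AMod V g T l i) (W : Submodule ℂ U.carrier) : Prop :=
  W ≠ ⊥ ∧ ∀ W' : Submodule ℂ U.carrier, W' ≤ W → U.SubInv W' → W' = ⊥ ∨ W' = W

/-- `U` is a simple `A_{g,n}(V)`-module. -/
def IsSimple (U : AMod V g T l i) : Prop :=
  (∃ x : U.carrier, x ≠ 0) ∧ ∀ W : Submodule ℂ U.carrier, U.SubInv W → W = ⊥ ∨ W = ⊤

/-- `U` is a direct sum of simple `A_{g,n}(V)`-modules. -/
def CompletelyReducible (U : AMod V g T l i) : Prop :=
  ∃ (κ : Type) (S : κ → Submodule ℂ U.carrier),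
    (∀ j, U.SubInv (S j) ∧ U.SubSimple (S j)) ∧ iSupIndep S ∧ (⨆ j, S j) = ⊤

/-- All irreducible components of `U` do not factor through `A_{g,n-1/T}(V)`. -/
def GoodComponents (U : AMod V g T l i) : Prop :=
  ∀ W : Submodule ℂ U.carrier, U.SubInv W → U.SubSimple W →
    ∃ a ∈ Ogn V g T (predL l i) (predI T i), ∃ x ∈ W, U.rho a x ≠ 0

end AMod

/-- A morphism of `A_{g,n}(V)`-modules. -/
structure AModHom {V : VOA} {g : VOAAut V} {T l i : ℕ} (U U' : AMod V g T l i) where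
  toLin : U.carrier →ₗ[ℂ] U'.carrier
  comm : ∀ (a : V.carrier) (x : U.carrier), toLin (U.rho a x) = U'.rho a (toLin x)

namespace AModHom

variable {V : VOA} {g : VOAAut V} {T l i : ℕ}

def id (U : AMod V g T l i) : AModHom U U := ⟨LinearMap.id, fun _ _ => rfl⟩

def comp {U U' U'' : AMod V g T l i} (f' : AModHom U' U'') (f : AModHom U U') :
    AModHom U U'' :=
  ⟨f'.toLin.comp f.toLin, fun a x => by simp only [LinearMap.comp_apply, f.comm, f'.comm]⟩

end AModHom

end DLM

namespace DLM

open DirectSum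

theorem exp_eq_primitiveRoot_pow (T : ℕ) (r t : ℕ) :
    Complex.exp ((2 * (Real.pi : ℂ) * Complex.I * (r : ℂ) * (t : ℂ)) / (T : ℂ)) =
      (Complex.exp (2 * (Real.pi : ℂ) * Complex.I / (T : ℂ)) ^ t) ^ r := by
  rw [← pow_mul, ← Complex.exp_nat_mul]
  congr 1
  push_cast
  ring

theorem eigProj_mem_eigSpace (V : VOA) (g : VOAAut V) {T : ℕ} (hT : 0 < T)
    (hg : g.lin ^ T = 1) (r : ℕ) (v : V.carrier) :
    eigProj V g T r v ∈ eigSpace V g T r := by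
  have hT' : (T : ℂ) ≠ 0 := by exact_mod_cast hT.ne'
  change g.lin (eigProj V g T r v) =
    Complex.exp (-(2 * (Real.pi : ℂ) * Complex.I * (r : ℂ)) / (T : ℂ)) • eigProj V g T r v
  unfold eigProj
  rw [map_smul, smul_comm, map_sum]
  congr 1
  rw [Finset.smul_sum]
  set f : ℕ → V.carrier := fun t =>
    Complex.exp (-(2 * (Real.pi : ℂ) * Complex.I * (r : ℂ)) / (T : ℂ)) •
      Complex.exp ((2 * (Real.pi : ℂ) * Complex.I * (r : ℂ) * (t : ℂ)) / (T : ℂ)) •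
      ((g.lin ^ t) v) with hf
  have hstep : ∀ t : ℕ, g.lin (Complex.exp ((2 * (Real.pi : ℂ) * Complex.I * (r : ℂ) *
      (t : ℂ)) / (T : ℂ)) • ((g.lin ^ t) v)) = f (t + 1) := by
    intro t
    simp only [hf]
    rw [map_smul, smul_smul, ← Complex.exp_add, pow_succ']
    congr 2
    push_cast
    field_simp
    ring
  have hends : f T = f 0 := by
    simp only [hf, hg]
    have h : 2 * (Real.pi : ℂ) * Complex.I * (r : ℂ) * (T : ℂ) / (T : ℂ) =
        (r : ℂ) * (2 * (Real.pi : ℂ) * Complex.I) := by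
      field_simp
    rw [h, Complex.exp_nat_mul_two_pi_mul_I]
    simp
  rw [Finset.sum_congr rfl fun t _ => hstep t]
  have h1 := Finset.sum_range_succ f T
  have h2 := Finset.sum_range_succ' f T
  rw [h1, hends] at h2
  exact (add_right_cancel h2).symm

theorem sum_eigProj (V : VOA) (g : VOAAut V) {T : ℕ} (hT : 0 < T) (v : V.carrier) :
    ∑ r ∈ Finset.range T, eigProj V g T r v = v := by
  have hT' : (T : ℂ) ≠ 0 := by exact_mod_cast hT.ne'
  have hζ := Complex.isPrimitiveRoot_exp T hT.ne'
  unfold eigProj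
  rw [← Finset.smul_sum, Finset.sum_comm]
  simp_rw [← Finset.sum_smul, exp_eq_primitiveRoot_pow]
  rw [Finset.sum_eq_single_of_mem 0 (Finset.mem_range.2 hT)]
  · simp [smul_smul, hT']
  · intro t ht ht0
    have hne : Complex.exp (2 * (Real.pi : ℂ) * Complex.I / (T : ℂ)) ^ t ≠ 1 :=
      hζ.pow_ne_one_of_pos_of_lt ht0 (Finset.mem_range.1 ht)
    rw [geom_sum_eq hne, ← pow_mul, mul_comm t T, pow_mul, hζ.pow_eq_one]
    simp

namespace TwModule

variable {V : VOA} {g : VOAAut V} {T : ℕ}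

/-- The span of all `u_m x` for a fixed vector `x`. -/
def orbitSpan (M : TwModule V g T) (x : M.carrier) : Submodule ℂ M.carrier :=
  Submodule.span ℂ {y | ∃ (u : V.carrier) (m : ℚ), y = M.act u m x}

theorem act_mem_orbitSpan (M : TwModule V g T) (x : M.carrier) (u : V.carrier) (m : ℚ) :
    M.act u m x ∈ M.orbitSpan x :=
  Submodule.subset_span ⟨u, m, rfl⟩

theorem self_mem_orbitSpan (M : TwModule V g T) (x : M.carrier) : x ∈ M.orbitSpan x := by
  simpa [M.act_vacuum] using M.act_mem_orbitSpan x V.vacuum (-1)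

theorem act_act_mem_orbitSpan_of_int (M : TwModule V g T) (x : M.carrier) {r s : ℕ}
    (hr : r < T) (hs : s < T) {u v : V.carrier} (hu : u ∈ eigSpace V g T r)
    (hv : v ∈ eigSpace V g T s) (e b : ℤ) :
    M.act u ((r : ℚ) / T + e) (M.act v ((s : ℚ) / T + b) x) ∈ M.orbitSpan x := by
  have hrT : (0 : ℚ) ≤ (r : ℚ) / T := by positivity
  have hsT : (0 : ℚ) ≤ (s : ℚ) / T := by positivity
  obtain ⟨a, ha⟩ := M.act_trunc u x
  obtain ⟨N, hN⟩ := M.act_trunc v x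
  have hvN : ∀ b : ℤ, N ≤ b → M.act v ((s : ℚ) / T + b) x = 0 := fun b hb =>
    hN _ (by have : (N : ℚ) ≤ b := by exact_mod_cast hb
             linarith)
  suffices H : ∀ (d : ℕ) (e b : ℤ), N - d ≤ b →
      M.act u ((r : ℚ) / T + e) (M.act v ((s : ℚ) / T + b) x) ∈ M.orbitSpan x from
    H (N - b).toNat e b (by omega)
  intro d
  induction d with
  | zero =>
    intro e b hb
    rw [hvN b (by simpa using hb), map_zero]
    exact zero_mem _
  | succ d ih =>
    intro e b hb
    have hua : ∀ j : ℕ, M.act u ((r : ℚ) / T + a + j) x = 0 := fun j =>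
      ha _ (by have : (0 : ℚ) ≤ j := by positivity
               linarith)
    have hJ := M.jacobi r s hr hs u hu v hv a b (e - a) x
    simp only [hua, map_zero, smul_zero, sub_zero] at hJ
    have hL : ∑ᶠ j : ℕ, ((qchoose ((r : ℚ) / (T : ℚ) + (a : ℚ)) j : ℚ) : ℂ) •
        M.act (V.mode u (e - a + j) v)
          ((r : ℚ) / (T : ℚ) + (s : ℚ) / (T : ℚ) + a + b - j) x ∈ M.orbitSpan x :=
      finsum_induction (· ∈ M.orbitSpan x) (zero_mem _) (fun _ _ h h' => add_mem h h')
        fun j => Submodule.smul_mem _ _ (M.act_mem_orbitSpan x _ _)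
    rw [hJ] at hL
    have hvj : ∀ j : ℕ, (N - b).toNat ≤ j → M.act v ((s : ℚ) / T + b + j) x = 0 := by
      intro j hj
      have := hvN (b + j) (by omega)
      push_cast at this
      rwa [← add_assoc] at this
    rw [finsum_eq_sum_of_support_subset (s := Finset.range ((N - b).toNat + 1)) _ (by
      intro j hj
      by_contra hj'
      refine hj ?_
      have : M.act v ((s : ℚ) / T + b + j) x = 0 := hvj j (by simp at hj'; omega)
      simp only [this, map_zero, smul_zero]), Finset.sum_range_succ'] at hL
    have hrest := (Submodule.add_mem_iff_right _ (Submodule.sum_mem _ fun j _ => ?_)).1 hL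
    · have he : (r : ℚ) / T + a + ((e - a : ℤ) : ℚ) = (r : ℚ) / T + e := by push_cast; ring
      simpa [qchoose, he] using hrest
    · refine Submodule.smul_mem _ _ ?_
      have hj := ih (e - ((j + 1 : ℕ) : ℤ)) (b + ((j + 1 : ℕ) : ℤ)) (by push_cast at hb ⊢; omega)
      have he : (r : ℚ) / T + a + ((e - a : ℤ) : ℚ) - ((j + 1 : ℕ) : ℚ) =
          (r : ℚ) / T + ((e - ((j + 1 : ℕ) : ℤ) : ℤ) : ℚ) := by push_cast; ring
      have hb' : (s : ℚ) / T + b + ((j + 1 : ℕ) : ℚ) =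
          (s : ℚ) / T + ((b + ((j + 1 : ℕ) : ℤ) : ℤ) : ℚ) := by push_cast; ring
      rwa [he, hb']

theorem act_act_mem_orbitSpan (M : TwModule V g T) (hT : 0 < T) (hg : g.lin ^ T = 1)
    (x : M.carrier) (u v : V.carrier) (p q : ℚ) :
    M.act u p (M.act v q x) ∈ M.orbitSpan x := by
  rw [← sum_eigProj V g hT u, ← sum_eigProj V g hT v]
  simp only [map_sum, Finset.sum_apply, LinearMap.sum_apply]
  refine Submodule.sum_mem _ fun s hs => Submodule.sum_mem _ fun r hr => ?_
  rw [Finset.mem_range] at hr hs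
  have hu := eigProj_mem_eigSpace V g hT hg r u
  have hv := eigProj_mem_eigSpace V g hT hg s v
  by_cases hp : ∃ z : ℤ, p = (z : ℚ) + (r : ℚ) / (T : ℚ)
  · by_cases hq : ∃ z : ℤ, q = (z : ℚ) + (s : ℚ) / (T : ℚ)
    · obtain ⟨e, rfl⟩ := hp
      obtain ⟨b, rfl⟩ := hq
      rw [add_comm (e : ℚ), add_comm (b : ℚ)]
      exact M.act_act_mem_orbitSpan_of_int x hr hs hu hv e b
    · simp [M.act_eig s hs _ hv q hq]
  · simp [M.act_eig r hr _ hu p hp]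

theorem act_mem_orbitSpan_of_mem (M : TwModule V g T) (hT : 0 < T) (hg : g.lin ^ T = 1)
    (x : M.carrier) (u : V.carrier) (m : ℚ) {y : M.carrier} (hy : y ∈ M.orbitSpan x) :
    M.act u m y ∈ M.orbitSpan x := by
  have h : M.orbitSpan x ≤ (M.orbitSpan x).comap (M.act u m) := by
    refine Submodule.span_le.2 ?_
    rintro _ ⟨v, q, rfl⟩
    exact M.act_act_mem_orbitSpan hT hg x u v m q
  exact h hy

/-- Induction on `orbitSpan` with generators `u_m x` for homogeneous `u`. -/
theorem orbitSpan_le (M : TwModule V g T) {x : M.carrier} {W : Submodule ℂ M.carrier}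
    (h : ∀ (k : ℤ), ∀ u ∈ V.wtSpace k, ∀ m : ℚ, M.act u m x ∈ W) : M.orbitSpan x ≤ W := by
  refine Submodule.span_le.2 ?_
  rintro _ ⟨u, m, rfl⟩
  classical
  rw [← DirectSum.sum_support_decompose V.wtSpace u]
  simp only [map_sum, Finset.sum_apply, LinearMap.sum_apply]
  exact Submodule.sum_mem _ fun k _ => h k _ (SetLike.coe_mem _) m

end TwModule

namespace AdmTwModule

variable {V : VOA} {g : VOAAut V} {T : ℕ}

/-- The projection of `M` onto its homogeneous component of degree `p`. -/
def gradeProj (M : AdmTwModule V g T) (p : ℚ) : M.carrier →ₗ[ℂ] M.carrier :=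
  (M.grade p).subtype ∘ₗ DirectSum.component ℂ ℚ (fun q => M.grade q) p ∘ₗ
    (decomposeLinearEquiv M.grade).toLinearMap

theorem gradeProj_apply (M : AdmTwModule V g T) (p : ℚ) (x : M.carrier) :
    M.gradeProj p x = ((decompose M.grade x p : M.grade p) : M.carrier) :=
  rfl

theorem decompose_act (M : AdmTwModule V g T) {k : ℤ} {u : V.carrier}
    (hu : u ∈ V.wtSpace k) (m q : ℚ) (x : M.carrier) :
    ((decompose M.grade (M.act u m x) (q + k - m - 1) : M.grade _) : M.carrier) =
      M.act u m ((decompose M.grade x q : M.grade q) : M.carrier) := by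
  induction x using DirectSum.Decomposition.inductionOn M.grade with
  | zero => simp
  | @homogeneous p y =>
    have hy := M.grade_act k u hu m p y y.2
    by_cases hpq : p = q
    · subst hpq
      rw [decompose_of_mem_same _ hy, decompose_of_mem_same _ y.2]
    · rw [decompose_of_mem_ne _ hy (fun h => hpq (by linarith)),
        decompose_of_mem_ne _ y.2 hpq, map_zero]
  | add a b ha hb => simp only [map_add, decompose_add, DirectSum.add_apply,
      Submodule.coe_add, ha, hb]

theorem gradedSub_Omega (M : AdmTwModule V g T) (n : ℚ) :
    M.GradedSub (M.toTwModule.Omega n) := by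
  intro x hx q k u hu m hm
  rw [← M.decompose_act hu, hx k u hu m hm]
  simp

theorem invSub_orbitSpan (M : AdmTwModule V g T) (hT : 0 < T) (hg : g.lin ^ T = 1)
    (x : M.carrier) : M.InvSub (M.toTwModule.orbitSpan x) := fun u m _ hy =>
  M.toTwModule.act_mem_orbitSpan_of_mem hT hg x u m hy

theorem gradedSub_orbitSpan (M : AdmTwModule V g T) {q : ℚ} {x : M.carrier}
    (hx : x ∈ M.grade q) : M.GradedSub (M.toTwModule.orbitSpan x) := by
  intro y hy p
  have h : M.toTwModule.orbitSpan x ≤ (M.toTwModule.orbitSpan x).comap (M.gradeProj p) := by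
    refine M.toTwModule.orbitSpan_le fun k u hu m => ?_
    have hmem := M.grade_act k u hu m q x hx
    rw [Submodule.mem_comap, gradeProj_apply]
    by_cases hp : q + k - m - 1 = p
    · subst hp
      rw [decompose_of_mem_same _ hmem]
      exact M.toTwModule.act_mem_orbitSpan x u m
    · rw [decompose_of_mem_ne _ hmem hp]
      exact zero_mem _
  exact h hy

theorem grade_le_Omega (M : AdmTwModule V g T) {p n : ℚ} (hpn : p ≤ n) :
    M.grade p ≤ M.toTwModule.Omega n := by
  intro x hx k u hu m hm
  have h := M.grade_act k u hu m p x hx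
  rw [M.grade_support _ (Or.inl (by linarith))] at h
  simpa using h

/-- In a simple module with `M(0) ≠ 0`, a nonzero homogeneous vector of `Ω_n(M)` has degree
at most `n`. -/
theorem IsSimple.le_of_mem_Omega {M : AdmTwModule V g T} (hM : M.IsSimple) (hT : 0 < T)
    (hg : g.lin ^ T = 1) (h0 : M.grade 0 ≠ ⊥) {n q : ℚ} {x : M.carrier} (hx0 : x ≠ 0)
    (hxq : x ∈ M.grade q) (hx : x ∈ M.toTwModule.Omega n) : q ≤ n := by
  by_contra! hq
  obtain ⟨y, hy, hy0⟩ := (Submodule.ne_bot_iff _).1 h0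
  have hself := M.toTwModule.self_mem_orbitSpan x
  rcases hM.2 _ (M.invSub_orbitSpan hT hg x) (M.gradedSub_orbitSpan hxq) with h | h
  · rw [h] at hself
    exact hx0 (by simpa using hself)
  · have hker : M.toTwModule.orbitSpan x ≤ LinearMap.ker (M.gradeProj 0) := by
      refine M.toTwModule.orbitSpan_le fun k u hu m => ?_
      rw [LinearMap.mem_ker, gradeProj_apply]
      rcases lt_or_ge ((k : ℚ) - 1 + n) m with hm | hm
      · simp [hx k u hu m hm]
      · exact decompose_of_mem_ne _ (M.grade_act k u hu m q x hxq) (by linarith)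
    have hy' : y ∈ M.toTwModule.orbitSpan x := h ▸ Submodule.mem_top
    have := hker hy'
    rw [LinearMap.mem_ker, gradeProj_apply, decompose_of_mem_same _ hy] at this
    exact hy0 this

end AdmTwModule

/-- **Proposition 3.4 (i).** Let `M = ⊕_{m ≥ 0} M(m)` be an admissible
`g`-twisted `V`-module with `M(0) ≠ 0`.  Then `Ω_n(M) ⊇ ⊕_{0 ≤ p ≤ n} M(p)`,
with equality when `M` is simple. -/
theorem Omega_contains_grades (V : VOA) (g : VOAAut V) (T : ℕ) (hT : 0 < T)
    (hg : g.lin ^ T = 1) (l i : ℕ) (hi : i ≤ T - 1)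
    (M : AdmTwModule V g T) (h0 : M.grade 0 ≠ ⊥) :
    (∀ p : ℚ, 0 ≤ p → p ≤ nval T l i →
      M.grade p ≤ M.toTwModule.Omega (nval T l i)) ∧
    (M.IsSimple →
      M.toTwModule.Omega (nval T l i) =
        ⨆ p ∈ Set.Icc (0 : ℚ) (nval T l i), M.grade p) := by
  refine ⟨fun p _ hp => M.grade_le_Omega hp, fun hM => le_antisymm (fun x hx => ?_) ?_⟩
  · classical
    rw [← sum_support_decompose M.grade x]
    refine Submodule.sum_mem _ fun q hq => ?_
    have hne : ((decompose M.grade x q : M.grade q) : M.carrier) ≠ 0 := by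
      simpa using hq
    have hmem : ((decompose M.grade x q : M.grade q) : M.carrier) ∈ M.grade q :=
      SetLike.coe_mem _
    have hqn := hM.le_of_mem_Omega hT hg h0 hne hmem (M.gradedSub_Omega _ x hx q)
    have hq0 : 0 ≤ q := by
      by_contra! hlt
      exact hne ((Submodule.mem_bot ℂ).1 ((M.grade_support q (Or.inl hlt)).le hmem))
    exact Submodule.mem_iSup_of_mem q (Submodule.mem_iSup_of_mem ⟨hq0, hqn⟩ hmem)
  · exact iSup₂_le fun p hp => M.grade_le_Omega hp.2

end DLM
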